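/- Assume N ≥ 2. Suppose δ ≥ 1 is an integer such that ord_0(f_h) ≤ δ for every h ∈ GL_{N+1}(k), and s ≥ −1 is an integer such that the Krull dimension of k[X_0,…,X_N]/J is at most s+1. Assume moreover that for every h ∈ GL_{N+1}(k) with ord_0(f_h) = δ, the lowest-degree homogeneous part in_δ(f_h) contains a monomial in which the variable x_{N−1} occurs (this quantified condition expresses that at every point P ∈ H(k) where H has multiplicity δ, the projective tangent cone P(C_P H) ⊂ P(T_P P^N_k) ≅ P^{N−1}_k is not the cone over a hypersurface contained in a projective hyperplane of P^{N−1}_k). If d ≥ (δ−1)·min(N+1, s+3), then for every g ∈ GL_{N+1}(k) and every nonzero α ∈ ℤ^{N+1} with Σ_{i=0}^N α_i = 0, one has deg_α(F∘g) ≥ 0; that is, F satisfies the Hilbert–Mumford criterion for semistability, so H is semistable. -/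

import Mathlib

open MvPolynomial

/-- The `α`-degree of a multivariate polynomial `G`: the maximum of `∑ i, m i * α i`
over the monomials `X^m` occurring in `G` with nonzero coefficient (0 if `G = 0`). -/
noncomputable def adeg {k : Type*} [CommSemiring k] {n : ℕ} (α : Fin n → ℤ)
    (G : MvPolynomial (Fin n) k) : ℤ :=
  if h : G.support.Nonempty then G.support.sup' h (fun m => ∑ i, (m i : ℤ) * α i) else 0

/-- `F ∘ g`: the polynomial obtained from `F` by the substitution `X i ↦ ∑ j, g i j • X j`. -/
noncomputable def substGL {k : Type*} [CommRing k] {n : ℕ}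
    (g : Matrix (Fin n) (Fin n) k) (F : MvPolynomial (Fin n) k) :
    MvPolynomial (Fin n) k :=
  aeval (fun i => ∑ j, C (g i j) * X j) F

/-- Dehomogenization with respect to the last variable:
`G(X_0, …, X_N) ↦ G(x_0, …, x_{N-1}, 1)`. -/
noncomputable def dehom {k : Type*} [CommRing k] {N : ℕ}
    (G : MvPolynomial (Fin (N+1)) k) : MvPolynomial (Fin N) k :=
  aeval (fun i : Fin (N+1) => if h : (i : ℕ) < N then X ⟨i, h⟩ else 1) G

/-- `ord_0 f`: the minimal total degree of a monomial occurring in `f`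
with nonzero coefficient (0 if `f = 0`). -/
noncomputable def ord0 {k : Type*} [CommSemiring k] {N : ℕ}
    (f : MvPolynomial (Fin N) k) : ℕ :=
  if h : f.support.Nonempty then f.support.inf' h (fun m => ∑ i, m i) else 0

/-- The ideal generated by `F` and its partial derivatives, defining the singular
locus `H_sing` of the hypersurface `H = {F = 0}`. -/
noncomputable def jacobianIdeal {k : Type*} [CommRing k] {N : ℕ}
    (F : MvPolynomial (Fin (N+1)) k) : Ideal (MvPolynomial (Fin (N+1)) k) :=
  Ideal.span ({F} ∪ Set.range (fun i => pderiv i F))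

lemma substGL_substGL {k : Type*} [CommRing k] {n : ℕ} (g h : Matrix (Fin n) (Fin n) k)
    (F : MvPolynomial (Fin n) k) : substGL h (substGL g F) = substGL (g * h) F := by
  unfold substGL
  rw [← AlgHom.comp_apply, comp_aeval]
  congr 2
  funext i
  simp only [map_sum, map_mul, aeval_X, algHom_C, algebraMap_eq, Matrix.mul_apply,
    Finset.mul_sum, Finset.sum_mul, mul_assoc]
  exact Finset.sum_comm

lemma substGL_one {k : Type*} [CommRing k] {n : ℕ} (F : MvPolynomial (Fin n) k) :
    substGL (1 : Matrix (Fin n) (Fin n) k) F = F := by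
  simp [substGL, Matrix.one_apply, ite_mul]

lemma substGL_ne_zero {k : Type*} [CommRing k] {n : ℕ} (g : Matrix.GeneralLinearGroup (Fin n) k)
    {F : MvPolynomial (Fin n) k} (hF : F ≠ 0) : substGL (g : Matrix (Fin n) (Fin n) k) F ≠ 0 := by
  intro h
  apply hF
  have := substGL_substGL (g : Matrix (Fin n) (Fin n) k) (↑g⁻¹) F
  rw [h, ← Units.val_mul, mul_inv_cancel, Units.val_one, substGL_one] at this
  simpa [substGL] using this.symm

lemma isHomogeneous_substGL {k : Type*} [CommRing k] {n d : ℕ} (g : Matrix (Fin n) (Fin n) k)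
    {F : MvPolynomial (Fin n) k} (hF : F.IsHomogeneous d) : (substGL g F).IsHomogeneous d := by
  have := hF.aeval (n := 1) (fun i => ∑ j, C (g i j) * X j)
    (fun i => IsHomogeneous.sum _ _ _ fun j _ => by
      simpa using (isHomogeneous_C _ (g i j)).mul (isHomogeneous_X k j))
  rwa [one_mul] at this

lemma pderiv_substGL {k : Type*} [CommRing k] {n : ℕ} (g : Matrix (Fin n) (Fin n) k)
    (F : MvPolynomial (Fin n) k) (j : Fin n) :
    pderiv j (substGL g F) = ∑ i, C (g i j) * substGL g (pderiv i F) := by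
  have h (i : Fin n) : pderiv j (∑ l, C (g i l) * X l : MvPolynomial (Fin n) k) = C (g i j) := by
    simp [pderiv_X, Pi.single_apply]
  have hX (i : Fin n) : aeval (fun i => ∑ l, C (g i l) * X l) (X i : MvPolynomial (Fin n) k) =
      ∑ l, C (g i l) * X l := aeval_X _ _
  unfold substGL
  generalize aeval (R := k) (fun i => ∑ l, C (g i l) * X l : Fin n → MvPolynomial (Fin n) k) = φ
    at hX ⊢
  induction F using MvPolynomial.induction_on with
  | C a => simp [← algebraMap_eq]
  | add p q hp hq => simp [hp, hq, mul_add, Finset.sum_add_distrib]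
  | mul_X p i hp =>
    rw [map_mul, Derivation.leibniz, hp, hX, h, ← hX]
    simp only [Derivation.leibniz, pderiv_X, Pi.single_apply, smul_eq_mul, mul_ite, mul_one,
      mul_zero, map_add, map_mul, mul_add, Finset.sum_add_distrib, Finset.mul_sum]
    congr 1
    · simp [apply_ite φ, mul_comm]
    · exact Finset.sum_congr rfl fun _ _ => mul_left_comm _ _ _

/-- The substitution by an invertible matrix, as an automorphism of the polynomial ring. -/
noncomputable def substGLEquiv {k : Type*} [CommRing k] {n : ℕ}
    (g : Matrix.GeneralLinearGroup (Fin n) k) :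
    MvPolynomial (Fin n) k ≃ₐ[k] MvPolynomial (Fin n) k :=
  AlgEquiv.ofBijective (aeval (fun i => ∑ j, C ((g : Matrix (Fin n) (Fin n) k) i j) * X j))
    (by
      have key (a b : Matrix.GeneralLinearGroup (Fin n) k) (hab : a * b = 1)
          (F : MvPolynomial (Fin n) k) : substGL (b : Matrix (Fin n) (Fin n) k)
            (substGL (a : Matrix (Fin n) (Fin n) k) F) = F := by
        rw [substGL_substGL, ← Units.val_mul, hab, Units.val_one, substGL_one]
      exact Function.bijective_iff_has_inverse.2 ⟨substGL (↑g⁻¹),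
        key g g⁻¹ (mul_inv_cancel g), key g⁻¹ g (inv_mul_cancel g)⟩)

lemma substGLEquiv_apply {k : Type*} [CommRing k] {n : ℕ}
    (g : Matrix.GeneralLinearGroup (Fin n) k) (F : MvPolynomial (Fin n) k) :
    substGLEquiv g F = substGL (g : Matrix (Fin n) (Fin n) k) F := rfl

lemma map_jacobianIdeal_le {k : Type*} [CommRing k] {N : ℕ}
    (g : Matrix.GeneralLinearGroup (Fin (N + 1)) k) (F : MvPolynomial (Fin (N + 1)) k) :
    (jacobianIdeal F).map (substGLEquiv g : _ →+* MvPolynomial (Fin (N + 1)) k) ≤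
      jacobianIdeal (substGL (g : Matrix (Fin (N + 1)) (Fin (N + 1)) k) F) := by
  rw [jacobianIdeal, Ideal.map_span, Ideal.span_le]
  rintro _ ⟨p, hp | ⟨i, rfl⟩, rfl⟩
  · rw [Set.mem_singleton_iff.1 hp]
    exact Ideal.subset_span (Or.inl rfl)
  · have h : substGL (g : Matrix (Fin (N + 1)) (Fin (N + 1)) k) (pderiv i F) =
        ∑ j, C ((↑g⁻¹ : Matrix (Fin (N + 1)) (Fin (N + 1)) k) j i) *
          pderiv j (substGL (g : Matrix (Fin (N + 1)) (Fin (N + 1)) k) F) := by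
      simp only [pderiv_substGL, Finset.mul_sum, ← mul_assoc, ← C_mul]
      rw [Finset.sum_comm]
      have h1 (l : Fin (N + 1)) : ∑ j, (↑g⁻¹ : Matrix (Fin (N + 1)) (Fin (N + 1)) k) j i *
          (g : Matrix (Fin (N + 1)) (Fin (N + 1)) k) l j =
            (1 : Matrix (Fin (N + 1)) (Fin (N + 1)) k) l i := by
        have hg : (g : Matrix (Fin (N + 1)) (Fin (N + 1)) k) *
            (↑g⁻¹ : Matrix (Fin (N + 1)) (Fin (N + 1)) k) = 1 := by
          rw [← Units.val_mul, mul_inv_cancel, Units.val_one]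
        rw [← hg, Matrix.mul_apply]
        exact Finset.sum_congr rfl fun _ _ => mul_comm _ _
      simp_rw [← Finset.sum_mul, ← map_sum, h1]
      simp [Matrix.one_apply, apply_ite]
    change substGL (g : Matrix (Fin (N + 1)) (Fin (N + 1)) k) (pderiv i F) ∈ _
    rw [h]
    exact Ideal.sum_mem _ fun j _ => Ideal.mul_mem_left _ _
      (Ideal.subset_span (Or.inr ⟨j, rfl⟩))

lemma ringKrullDim_quotient_jacobianIdeal_substGL_le {k : Type*} [CommRing k] {N : ℕ}
    (g : Matrix.GeneralLinearGroup (Fin (N + 1)) k) (F : MvPolynomial (Fin (N + 1)) k) :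
    ringKrullDim (MvPolynomial (Fin (N + 1)) k ⧸
        jacobianIdeal (substGL (g : Matrix (Fin (N + 1)) (Fin (N + 1)) k) F)) ≤
      ringKrullDim (MvPolynomial (Fin (N + 1)) k ⧸ jacobianIdeal F) := by
  rw [ringKrullDim_eq_of_ringEquiv (Ideal.quotientEquiv (jacobianIdeal F) _
    (substGLEquiv g).toRingEquiv rfl)]
  exact ringKrullDim_le_of_surjective _ (Ideal.Quotient.factor_surjective
    (map_jacobianIdeal_le g F))

/-- The endomorphism of the polynomial ring killing the variables of index less than `j`. -/
noncomputable def killVars (k : Type*) [CommRing k] (n j : ℕ) :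
    MvPolynomial (Fin n) k →ₐ[k] MvPolynomial (Fin n) k :=
  aeval fun i => if (i : ℕ) < j then 0 else X i

instance isPrime_ker_killVars (k : Type*) [Field k] (n j : ℕ) :
    (RingHom.ker (killVars k n j)).IsPrime :=
  RingHom.ker_isPrime (killVars k n j)

lemma le_height_ker_killVars (k : Type*) [Field k] {n j : ℕ} (hj : j ≤ n) :
    (j : ℕ∞) ≤ (RingHom.ker (killVars k n j)).height := by
  induction j with
  | zero => simp
  | succ j ih =>
    have hlt : RingHom.ker (killVars k n j) < RingHom.ker (killVars k n (j + 1)) := by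
      refine lt_of_le_of_ne (fun p hp => ?_) fun h => ?_
      · have hc : (killVars k n (j + 1)).comp (killVars k n j) = killVars k n (j + 1) := by
          refine algHom_ext fun i => ?_
          by_cases hi : (i : ℕ) < j
          · simp [killVars, hi, hi.le]
          · simp [killVars, hi]
        rw [RingHom.mem_ker] at hp ⊢
        rw [← hc, AlgHom.comp_apply, hp, map_zero]
      · have : (X ⟨j, hj⟩ : MvPolynomial (Fin n) k) ∈ RingHom.ker (killVars k n j) := by
          rw [h, RingHom.mem_ker]
          simp [killVars]
        rw [RingHom.mem_ker] at this
        simp [killVars] at this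
    have := Ideal.height_add_one_le_of_lt_of_isPrime hlt
    push_cast
    exact (add_le_add_left (ih (by omega)) 1).trans this

lemma le_ringKrullDim_quotient_span_add_encard {k : Type*} [Field k] {n : ℕ}
    (s : Set (MvPolynomial (Fin n) k)) (hs : ∀ p ∈ s, constantCoeff p = 0) :
    (n : WithBot ℕ∞) ≤ ringKrullDim (MvPolynomial (Fin n) k ⧸ Ideal.span s) + s.encard := by
  have hle : s ⊆ RingHom.ker (killVars k n n) := fun p hp => by
    have : killVars k n n = (Algebra.ofId k _).comp (aeval 0) := algHom_ext fun i => by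
      simp [killVars]
    rw [SetLike.mem_coe, RingHom.mem_ker, this, AlgHom.comp_apply]
    simp [hs p hp]
  refine le_trans ?_ (Ideal.height_le_ringKrullDim_quotient_add_encard s hle)
  exact_mod_cast le_height_ker_killVars k le_rfl

lemma sum_mul_lt_zero_of_adeg_lt_zero {k : Type*} [CommSemiring k] {n : ℕ} {α : Fin n → ℤ}
    {G : MvPolynomial (Fin n) k} (h : adeg α G < 0) {m : Fin n →₀ ℕ} (hm : m ∈ G.support) :
    ∑ i, (m i : ℤ) * α i < 0 := by
  have hne : G.support.Nonempty := ⟨m, hm⟩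
  rw [adeg, dif_pos hne] at h
  exact (Finset.le_sup' (fun m : Fin n →₀ ℕ => ∑ i, (m i : ℤ) * α i) hm).trans_lt h

lemma exists_mem_support_sum_eq_ord0 {k : Type*} [CommSemiring k] {n : ℕ}
    {f : MvPolynomial (Fin n) k} (hf : f ≠ 0) : ∃ m ∈ f.support, ∑ i, m i = ord0 f := by
  have hne : f.support.Nonempty := support_nonempty.2 hf
  obtain ⟨m, hm, h⟩ := Finset.exists_mem_eq_inf' hne (fun m : Fin n →₀ ℕ => ∑ i, m i)
  exact ⟨m, hm, by rw [ord0, dif_pos hne, h]⟩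

lemma sum_eq_of_mem_support {k : Type*} [CommSemiring k] {n d : ℕ} {G : MvPolynomial (Fin n) k}
    (hG : G.IsHomogeneous d) {m : Fin n →₀ ℕ} (hm : m ∈ G.support) : ∑ i, m i = d := by
  rw [← hG (mem_support_iff.1 hm), Finsupp.weight_apply, Finsupp.sum_fintype _ _ (by simp)]
  simp

lemma dehom_eq_sum {k : Type*} [CommRing k] {N : ℕ} (G : MvPolynomial (Fin (N + 1)) k) :
    dehom G = ∑ m ∈ G.support,
      monomial (m.comapDomain Fin.castSucc (Fin.castSucc_injective N).injOn) (coeff m G) := by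
  rw [dehom, aeval_def, eval₂_eq']
  refine Finset.sum_congr rfl fun m _ => ?_
  rw [Fin.prod_univ_castSucc, monomial_eq, Finsupp.prod_fintype _ _ (by simp)]
  simp

lemma exists_mem_support_of_mem_support_dehom {k : Type*} [CommRing k] {N : ℕ}
    {G : MvPolynomial (Fin (N + 1)) k} {m' : Fin N →₀ ℕ} (hm' : m' ∈ (dehom G).support) :
    ∃ m ∈ G.support, ∀ i : Fin N, m i.castSucc = m' i := by
  classical
  rw [mem_support_iff, dehom_eq_sum, coeff_sum] at hm'
  obtain ⟨m, hm, h⟩ := Finset.exists_ne_zero_of_sum_ne_zero hm'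
  rw [coeff_monomial] at h
  refine ⟨m, hm, fun i => ?_⟩
  rw [← (ite_ne_right_iff.1 h).1]
  simp

lemma dehom_ne_zero {k : Type*} [CommRing k] {N d : ℕ}
    {G : MvPolynomial (Fin (N + 1)) k} (hG : G.IsHomogeneous d) (hG0 : G ≠ 0) : dehom G ≠ 0 := by
  classical
  obtain ⟨m, hm⟩ := support_nonempty.2 hG0
  intro h
  have hc := congrArg
    (coeff (m.comapDomain Fin.castSucc (Fin.castSucc_injective N).injOn)) h
  rw [dehom_eq_sum, coeff_sum, coeff_zero, Finset.sum_eq_single m] at hc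
  · rw [coeff_monomial, if_pos rfl] at hc
    exact mem_support_iff.1 hm hc
  · intro m₁ hm₁ hne
    rw [coeff_monomial, if_neg]
    intro heq
    have hi (i : Fin N) : m₁ i.castSucc = m i.castSucc := by
      simpa using DFunLike.congr_fun heq i
    have h1 := sum_eq_of_mem_support hG hm₁
    have h2 := sum_eq_of_mem_support hG hm
    rw [Fin.sum_univ_castSucc] at h1 h2
    simp only [hi] at h1
    refine hne (Finsupp.ext fun i => ?_)
    induction i using Fin.lastCases with
    | last => omega
    | cast i => exact hi i
  · exact fun h => absurd hm h

lemma weight_lt_zero_of_mult_le {k : Type*} [CommRing k] {N d : ℕ} (hN : 1 ≤ N)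
    {G : MvPolynomial (Fin (N + 1)) k} (hG : G.IsHomogeneous d) (hG0 : G ≠ 0)
    {β : Fin (N + 1) → ℤ} (hβ : Monotone β)
    (hneg : ∀ m ∈ G.support, ∑ i, (m i : ℤ) * β i < 0) {δ : ℕ}
    (hmult : ord0 (dehom G) ≤ δ)
    (hcone : ord0 (dehom G) = δ →
      ∃ m ∈ (dehom G).support, (∑ i, m i) = δ ∧ m ⟨N - 1, by omega⟩ ≠ 0) :
    ((d : ℤ) - δ) * β (Fin.last N) + β ⟨N - 1, by omega⟩ + ((δ : ℤ) - 1) * β 0 < 0 := by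
  have hN1 : β ⟨N - 1, by omega⟩ ≤ β (Fin.last N) := hβ (Fin.le_last _)
  have h0 : β 0 ≤ β (Fin.last N) := hβ (Fin.le_last _)
  have key {m' : Fin N →₀ ℕ} (hm' : m' ∈ (dehom G).support) :
      ((d : ℤ) - (∑ i, m' i : ℕ)) * β (Fin.last N) + ∑ i : Fin N, (m' i : ℤ) * β i.castSucc < 0 := by
    obtain ⟨m, hm, h⟩ := exists_mem_support_of_mem_support_dehom hm'
    have h1 := sum_eq_of_mem_support hG hm
    have h2 := hneg m hm
    rw [Fin.sum_univ_castSucc] at h1 h2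
    simp only [h] at h1 h2
    have h3 : ((d : ℤ) - (∑ i, m' i : ℕ)) = m (Fin.last N) := by rw [← h1]; push_cast; ring
    rw [h3]
    linarith
  rcases hmult.lt_or_eq with hlt | heq
  · obtain ⟨m', hm', hs⟩ := exists_mem_support_sum_eq_ord0 (dehom_ne_zero hG hG0)
    have h1 := key hm'
    have h2 : ((∑ i, m' i : ℕ) : ℤ) * β 0 ≤ ∑ i : Fin N, (m' i : ℤ) * β i.castSucc := by
      push_cast
      rw [Finset.sum_mul]
      exact Finset.sum_le_sum fun i _ => mul_le_mul_of_nonneg_left (hβ (Fin.zero_le _)) (by simp)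
    have h3 : ((∑ i, m' i : ℕ) : ℤ) + 1 ≤ δ := by rw [hs]; exact_mod_cast hlt
    nlinarith
  · obtain ⟨m', hm', hs, hne⟩ := hcone heq
    have h1 := key hm'
    have h2 : β ⟨N - 1, by omega⟩ - β 0 ≤ ∑ i : Fin N, (m' i : ℤ) * (β i.castSucc - β 0) := by
      have hnn (i : Fin N) : 0 ≤ (m' i : ℤ) * (β i.castSucc - β 0) :=
        mul_nonneg (by simp) (sub_nonneg.2 (hβ (Fin.zero_le _)))
      refine le_trans ?_ (Finset.single_le_sum (fun i _ => hnn i)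
        (Finset.mem_univ (⟨N - 1, by omega⟩ : Fin N)))
      refine le_mul_of_one_le_left (sub_nonneg.2 (hβ (Fin.zero_le _))) ?_
      exact_mod_cast Nat.one_le_iff_ne_zero.2 hne
    simp only [mul_sub, Finset.sum_sub_distrib, ← Finset.sum_mul] at h2
    have h3 : ∑ i, (m' i : ℤ) = δ := by exact_mod_cast hs
    rw [hs] at h1
    rw [h3] at h2
    linarith

lemma add_mul_lt_zero_of_ringKrullDim_le {k : Type*} [Field k] {N d S : ℕ} (hd : 2 ≤ d)
    {G : MvPolynomial (Fin (N + 1)) k} (hG : G.IsHomogeneous d)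
    {β : Fin (N + 1) → ℤ} (hβ : Monotone β)
    (hneg : ∀ m ∈ G.support, ∑ i, (m i : ℤ) * β i < 0)
    (hsing : ringKrullDim (MvPolynomial (Fin (N + 1)) k ⧸ jacobianIdeal G) ≤ (S : WithBot ℕ∞))
    {i j : Fin (N + 1)} (hij : i ≤ j) (hS : (i : ℕ) + j + S = N) :
    β i + ((d : ℤ) - 1) * β j < 0 := by
  classical
  by_contra! hcon
  have hd' : (2 : ℤ) ≤ d := by exact_mod_cast hd
  have hj : 0 ≤ β j := by
    by_contra! hj
    have := hβ hij
    nlinarith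
  have hvars : ∀ m ∈ G.support, ∃ l ∈ Set.Iio j, m l ≠ 0 := by
    intro m hm
    by_contra! hzero
    refine (hneg m hm).not_ge (Finset.sum_nonneg fun l _ => ?_)
    rcases lt_or_ge l j with hl | hl
    · simp [hzero l hl]
    · exact mul_nonneg (by simp) (hj.trans (hβ hl))
  have hpderiv : ∀ l : Fin (N + 1), i ≤ l → ∀ m ∈ (pderiv l G).support,
      ∃ l' ∈ Set.Iio j, m l' ≠ 0 := by
    intro l hl m hm
    have hm1 : m + Finsupp.single l 1 ∈ G.support := by
      rw [mem_support_iff, coeff_pderiv] at hm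
      exact mem_support_iff.2 (left_ne_zero_of_mul hm)
    by_contra! hzero
    have h1 := sum_eq_of_mem_support hG hm1
    have h2 := hneg _ hm1
    simp only [Finsupp.add_apply, Finset.sum_add_distrib, Finsupp.single_apply,
      Finset.sum_ite_eq, Finset.mem_univ, if_true, Nat.cast_add, add_mul, Nat.cast_ite,
      Nat.cast_one, Nat.cast_zero, ite_mul, one_mul, zero_mul] at h1 h2
    have h3 : (∑ l', (m l' : ℤ)) * β j ≤ ∑ l', (m l' : ℤ) * β l' := by
      rw [Finset.sum_mul]
      refine Finset.sum_le_sum fun l' _ => ?_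
      rcases lt_or_ge l' j with hl' | hl'
      · simp [hzero l' hl']
      · exact mul_le_mul_of_nonneg_left (hβ hl') (by simp)
    have h4 : ∑ l', (m l' : ℤ) = d - 1 := by
      rw [← h1]; push_cast; ring
    rw [h4] at h3
    linarith [hβ hl]
  set s : Set (MvPolynomial (Fin (N + 1)) k) := X '' Set.Iio j ∪ (pderiv · G) '' Set.Iio i
  have hle : jacobianIdeal G ≤ Ideal.span s := by
    have hX : Ideal.span (X '' Set.Iio j) ≤ Ideal.span s :=
      Ideal.span_mono Set.subset_union_left
    rw [jacobianIdeal, Ideal.span_le]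
    rintro _ (rfl | ⟨l, rfl⟩)
    · exact hX (mem_ideal_span_X_image.2 hvars)
    · rcases lt_or_ge l i with hl | hl
      · exact Ideal.subset_span (Or.inr ⟨l, hl, rfl⟩)
      · exact hX (mem_ideal_span_X_image.2 (hpderiv l hl))
  have hconst : ∀ p ∈ s, constantCoeff p = 0 := by
    rintro _ (⟨l, -, rfl⟩ | ⟨l, -, rfl⟩)
    · simp
    · rw [constantCoeff_eq, coeff_pderiv]
      have : coeff (0 + Finsupp.single l 1) G = 0 := by
        by_contra hne
        have := sum_eq_of_mem_support hG (mem_support_iff.2 hne)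
        simp [Finsupp.single_apply] at this
        omega
      rw [this, zero_mul]
  have hcard : s.encard ≤ ((j + i : ℕ) : ℕ∞) := by
    refine (Set.encard_union_le _ _).trans ?_
    push_cast
    refine add_le_add ((Set.encard_image_le _ _).trans ?_) ((Set.encard_image_le _ _).trans ?_) <;>
    simp [← Finset.coe_Iio]
  have h1 := le_ringKrullDim_quotient_span_add_encard s hconst
  have h2 : ringKrullDim (MvPolynomial (Fin (N + 1)) k ⧸ Ideal.span s) ≤ (S : WithBot ℕ∞) :=
    (ringKrullDim_le_of_surjective _ (Ideal.Quotient.factor_surjective hle)).trans hsing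
  have h3 : ((N + 1 : ℕ) : WithBot ℕ∞) ≤ ((S + (j + i) : ℕ) : WithBot ℕ∞) := by
    refine h1.trans ?_
    push_cast
    exact add_le_add h2 (by exact_mod_cast hcard)
  have h4 : N + 1 ≤ S + (j + i) := by exact_mod_cast h3
  omega

lemma sum_range_lt_zero_of_pairs {b : ℕ → ℤ} {N : ℕ}
    (hpair : ∀ i j, i + j = N → b i + b j < 0) : ∑ i ∈ Finset.range (N + 1), b i < 0 := by
  have h : ∑ i ∈ Finset.range (N + 1), (b i + b (N + 1 - 1 - i)) < 0 :=
    Finset.sum_neg (fun i hi => hpair _ _ (by rw [Finset.mem_range] at hi; omega)) ⟨0, by simp⟩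
  rw [Finset.sum_add_distrib, Finset.sum_range_reflect] at h
  linarith

lemma neg_le_of_sum_eq_zero {b : ℕ → ℤ} (hb : Monotone b) {N S : ℕ} (hSN : S + 2 ≤ N)
    (hsum : ∑ i ∈ Finset.range (N + 1), b i = 0)
    (hpair : ∀ i j, i + j + S = N → b i + b j < 0) : -b 0 ≤ b N + S * b (N - 1) := by
  obtain ⟨M, rfl⟩ : ∃ M, N = M + 1 + 1 + S := ⟨N - S - 2, by omega⟩
  have h1 : ∑ i ∈ Finset.range (M + 1), b (i + 1) < 0 :=
    sum_range_lt_zero_of_pairs (b := fun i => b (i + 1))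
      fun i j hij => hpair _ _ (by omega)
  have h2 : ∑ i ∈ Finset.range S, b (M + 1 + 1 + i) ≤ S * b (M + 1 + 1 + S - 1) := by
    refine (Finset.sum_le_card_nsmul _ _ (b (M + 1 + 1 + S - 1)) fun i hi => hb ?_).trans (by simp)
    rw [Finset.mem_range] at hi
    omega
  rw [Finset.sum_range_succ, Finset.sum_range_add, Finset.sum_range_succ'] at hsum
  linarith

lemma neg_le_sub_one_mul_of_sum_eq_zero {b : ℕ → ℤ} (hb : Monotone b) {N : ℕ} (hN : 1 ≤ N)
    (hsum : ∑ i ∈ Finset.range (N + 1), b i = 0) :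
    -b 0 ≤ b N + ((N - 1 : ℕ) : ℤ) * b (N - 1) := by
  obtain ⟨M, rfl⟩ : ∃ M, N = M + 1 := ⟨N - 1, by omega⟩
  have h : ∑ i ∈ Finset.range M, b (i + 1) ≤ M * b M := by
    refine (Finset.sum_le_card_nsmul _ _ (b M) fun i hi => hb ?_).trans (by simp)
    rw [Finset.mem_range] at hi
    omega
  rw [Finset.sum_range_succ, Finset.sum_range_succ'] at hsum
  simp only [Nat.add_sub_cancel]
  linarith

lemma false_of_weight_inequalities {b : ℕ → ℤ} (hb : Monotone b) {N S d δ : ℕ} (hN : 2 ≤ N)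
    (hd : 2 ≤ d) (hδ : 1 ≤ δ) (hsum : ∑ i ∈ Finset.range (N + 1), b i = 0) (hpos : 0 < b N)
    (hmult : ((d : ℤ) - δ) * b N + b (N - 1) + ((δ : ℤ) - 1) * b 0 < 0)
    (hsing : ∀ i j, i ≤ j → i + j + S = N → b i + ((d : ℤ) - 1) * b j < 0)
    (hdeg : ((δ : ℤ) - 1) * min ((N : ℤ) + 1) (S + 2) ≤ d) : False := by
  have hd' : (2 : ℤ) ≤ d := by exact_mod_cast hd
  have hle : b (N - 1) ≤ b N := hb (Nat.sub_le _ _)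
  have hN1 := neg_le_sub_one_mul_of_sum_eq_zero hb (by omega) hsum
  have hcN : (1 : ℤ) ≤ ((N - 1 : ℕ) : ℤ) := by exact_mod_cast (by omega : 1 ≤ N - 1)
  have htop : 0 ≤ b N + b (N - 1) := by
    by_contra! h
    have h0 : b 0 ≤ b (N - 1) := hb (Nat.zero_le _)
    nlinarith
  have key (c : ℕ) (hc : (1 : ℤ) ≤ c) (hbc : -b 0 ≤ b N + c * b (N - 1))
      (hdc : ((δ : ℤ) - 1) * (c + 2) ≤ d) : False := by
    rcases hδ.eq_or_lt with h | h
    · rw [← h] at hmult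
      push_cast at hmult
      nlinarith
    · have hδ' : (1 : ℤ) ≤ δ - 1 := by
        have : (2 : ℤ) ≤ δ := by exact_mod_cast h
        linarith
      have h1 : 1 ≤ ((δ : ℤ) - 1) * c := by nlinarith
      have h2 : ((δ : ℤ) - 1) * -b 0 ≤ ((δ : ℤ) - 1) * (b N + c * b (N - 1)) :=
        mul_le_mul_of_nonneg_left hbc (by linarith)
      have h3 : 0 ≤ (((δ : ℤ) - 1) * c - 1) * (b N - b (N - 1)) :=
        mul_nonneg (by linarith) (by linarith)
      have h4 : ((δ : ℤ) - 1) * (c + 2) * b N ≤ d * b N :=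
        mul_le_mul_of_nonneg_right hdc hpos.le
      linarith
  rcases le_or_gt (N + 1) (S + 2) with hS | hS
  · rw [min_eq_left (by exact_mod_cast hS)] at hdeg
    refine key (N - 1) hcN hN1 ?_
    have : ((N - 1 : ℕ) : ℤ) + 2 = N + 1 := by omega
    rwa [this]
  · have hle_pair (i j : ℕ) (hij : i ≤ j) (h : i + j + S = N) : b i + b j < 0 := by
      have h1 := hsing i j hij h
      have h2 := hb hij
      rcases le_or_gt 0 (b j) with h3 | h3
      · nlinarith
      · linarith
    have hpair (i j : ℕ) (h : i + j + S = N) : b i + b j < 0 := by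
      rcases le_total i j with hij | hij
      · exact hle_pair i j hij h
      · rw [add_comm]
        exact hle_pair j i hij (by omega)
    rcases S.eq_zero_or_pos with rfl | hS0
    · exact (sum_range_lt_zero_of_pairs hpair).ne hsum
    · rw [min_eq_right (by exact_mod_cast hS.le)] at hdeg
      exact key S (by exact_mod_cast hS0) (neg_le_of_sum_eq_zero hb (by omega) hsum hpair) hdeg

lemma last_pos_of_sum_eq_zero {N : ℕ} {β : Fin (N + 1) → ℤ} (hβ : Monotone β) (hβ0 : β ≠ 0)
    (hsum : ∑ i, β i = 0) : 0 < β (Fin.last N) := by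
  by_contra! h
  have hle : ∀ i ∈ Finset.univ, β i ≤ 0 := fun i _ => (hβ (Fin.le_last i)).trans h
  exact hβ0 (funext fun i => (Finset.sum_eq_zero_iff_of_nonpos hle).1 hsum i (Finset.mem_univ i))

/-- The invertible matrix whose substitution renames the variables along a permutation. -/
noncomputable def permGL (k : Type*) [CommRing k] {n : ℕ} (σ : Equiv.Perm (Fin n)) :
    Matrix.GeneralLinearGroup (Fin n) k :=
  Matrix.GeneralLinearGroup.mk'' (σ.permMatrix k) (by
    rw [Matrix.det_permutation]
    exact (Units.isUnit σ.sign).map (Int.castRingHom k))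

lemma substGL_permGL {k : Type*} [CommRing k] {n : ℕ} (σ : Equiv.Perm (Fin n))
    (F : MvPolynomial (Fin n) k) :
    substGL (permGL k σ : Matrix (Fin n) (Fin n) k) F = rename σ F := by
  rw [substGL, rename_eq_aeval]
  congr 2
  funext i
  change ∑ j, C (σ.permMatrix k i j) * X j = X (σ i)
  simp [PEquiv.toMatrix_apply, Equiv.toPEquiv_apply]

lemma exists_mem_support_of_mem_support_rename {k : Type*} [CommRing k] {n : ℕ}
    {σ : Equiv.Perm (Fin n)} {F : MvPolynomial (Fin n) k} {m : Fin n →₀ ℕ}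
    (hm : m ∈ (rename σ F).support) : ∃ m' ∈ F.support, ∀ i, m (σ i) = m' i := by
  classical
  rw [support_rename_of_injective σ.injective, Finset.mem_image] at hm
  obtain ⟨m', hm', rfl⟩ := hm
  exact ⟨m', hm', fun i => Finsupp.mapDomain_apply σ.injective _ _⟩

/-- Assume `N ≥ 2`. If the multiplicity of `H = {F = 0}` at every point is at most `δ`,
at every point of multiplicity exactly `δ` the lowest-degree homogeneous part of the
local equation contains a monomial involving `x_{N-1}` (i.e. the projective tangent
cone is not a cone over a hypersurface in a projective hyperplane), `dim H_sing ≤ s`,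
and `d ≥ (δ-1) · min(N+1, s+3)`, then `F` satisfies the Hilbert–Mumford criterion for
semistability, i.e. `H` is semistable. -/
theorem semistable_of_deg_ge_of_tangentCone_not_cone {k : Type*} [Field k] [IsAlgClosed k]
    {N d : ℕ} (hN : 2 ≤ N) (hd : 2 ≤ d)
    (F : MvPolynomial (Fin (N+1)) k) (hF0 : F ≠ 0) (hFhom : F.IsHomogeneous d)
    (δ : ℕ) (hδ : 1 ≤ δ)
    (hmult : ∀ h : Matrix.GeneralLinearGroup (Fin (N+1)) k,
      ord0 (dehom (substGL (↑h) F)) ≤ δ)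
    (hcone : ∀ h : Matrix.GeneralLinearGroup (Fin (N+1)) k,
      ord0 (dehom (substGL (↑h) F)) = δ →
      ∃ m ∈ (dehom (substGL (↑h) F)).support,
        (∑ i, m i) = δ ∧ m ⟨N-1, by omega⟩ ≠ 0)
    (s : ℤ) (hs : -1 ≤ s)
    (hsing : ringKrullDim (MvPolynomial (Fin (N+1)) k ⧸ jacobianIdeal F)
      ≤ ((s+1).toNat : WithBot ℕ∞))
    (hdeg : ((δ : ℤ) - 1) * min ((N : ℤ) + 1) (s + 3) ≤ (d : ℤ)) :
    ∀ g : Matrix.GeneralLinearGroup (Fin (N+1)) k, ∀ α : Fin (N+1) → ℤ,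
      α ≠ 0 → (∑ i, α i) = 0 → 0 ≤ adeg α (substGL (↑g) F) := by
  intro g α hα hsum
  by_contra! hneg
  set σ := Tuple.sort α
  set h : Matrix.GeneralLinearGroup (Fin (N + 1)) k := g * permGL k σ⁻¹ with hh
  set β : Fin (N + 1) → ℤ := α ∘ σ with hβdef
  have hβ : Monotone β := Tuple.monotone_sort α
  have hβ0 : β ≠ 0 := fun h0 => hα (funext fun i => by
    simpa [hβdef] using congrFun h0 (σ⁻¹ i))
  have hβsum : ∑ i, β i = 0 := (Equiv.sum_comp σ α).trans hsum
  set G := substGL (h : Matrix (Fin (N + 1)) (Fin (N + 1)) k) F with hG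
  have hGeq : G = rename (⇑σ⁻¹)
      (substGL (g : Matrix (Fin (N + 1)) (Fin (N + 1)) k) F) := by
    rw [hG, hh, Units.val_mul, ← substGL_substGL, substGL_permGL]
  have hGhom : G.IsHomogeneous d := isHomogeneous_substGL _ hFhom
  have hGneg : ∀ m ∈ G.support, ∑ i, (m i : ℤ) * β i < 0 := by
    intro m hm
    rw [hGeq] at hm
    obtain ⟨m', hm', hmm'⟩ := exists_mem_support_of_mem_support_rename hm
    have hlt := sum_mul_lt_zero_of_adeg_lt_zero hneg hm'
    rw [← Equiv.sum_comp σ⁻¹]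
    simp_rw [hmm']
    simpa [hβdef] using hlt
  have hmultG := weight_lt_zero_of_mult_le (by omega) hGhom (substGL_ne_zero h hF0) hβ hGneg
    (hmult h) (hcone h)
  have hsingG := (ringKrullDim_quotient_jacobianIdeal_substGL_le h F).trans hsing
  let b : ℕ → ℤ := fun i => β ⟨min i N, by omega⟩
  have hbβ (i : ℕ) (hi : i < N + 1) : b i = β ⟨i, hi⟩ :=
    congrArg β (Fin.ext (min_eq_left (by omega)))
  have hb : Monotone b := fun i j hij => hβ (Fin.mk_le_mk.2 (min_le_min_right N hij))
  refine false_of_weight_inequalities hb (S := (s + 1).toNat) hN hd hδ ?_ ?_ ?_ ?_ ?_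
  · rw [← Fin.sum_univ_eq_sum_range, ← hβsum]
    exact Finset.sum_congr rfl fun i _ => hbβ i i.2
  · rw [hbβ N (by omega)]
    exact last_pos_of_sum_eq_zero hβ hβ0 hβsum
  · rw [hbβ N (by omega), hbβ (N - 1) (by omega), hbβ 0 (by omega)]
    exact hmultG
  · intro i j hij hS
    rw [hbβ i (by omega), hbβ j (by omega)]
    exact add_mul_lt_zero_of_ringKrullDim_le hd hGhom hβ hGneg hsingG
      (Fin.mk_le_mk.2 hij) hS
  · have : (((s + 1).toNat : ℕ) : ℤ) + 2 = s + 3 := by omega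
    rwa [this]
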